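/- arXiv:2104.04410 — 2 statements merged into one kernel-verified Lean document; each statement's English description precedes it below -/
import Mathlib

section
/- Let k ≥ 4 be an integer and let λ : ℕ → ℝ be a multiplicative arithmetic function. Let P be a set of primes, all of size at least 16, such that for every p ∈ P and every integer m ≥ 1 one has |λ(p^m)| ≥ p^((k-1)m/2) · (log log p)/(log p)^(1/2), and suppose |λ(n)| ≤ d(n)·n^((k-1)/2) for all n ≥ 1, where d(n) is the number of divisors of n. Then for every ε > 0 there is N such that for every integer n ≥ N all of whose prime divisors lie in P, one has n^((k-3)/2 + (log log log n)/(log log n)) ≤ |λ(n)| ≤ n^((k-1)/2 + ε). -/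
/-- On `ℕ`, `m + 1 ≤ C * p ^ (δ m)` with `C` uniform in `p ≥ 2`. -/
theorem exists_add_one_le_mul_pow_rpow {δ : ℝ} (hδ : 0 < δ) :
    ∃ C : ℝ, 1 ≤ C ∧ ∀ p a : ℕ, 2 ≤ p → (a : ℝ) + 1 ≤ C * ((p : ℝ) ^ a) ^ δ := by
  have hl : 0 < δ * Real.log 2 := mul_pos hδ (Real.log_pos (by norm_num))
  refine ⟨max 1 (1 / (δ * Real.log 2)), le_max_left _ _, fun p a hp => ?_⟩
  have hp' : (2 : ℝ) ≤ p := by exact_mod_cast hp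
  have h1 : 1 + a * (δ * Real.log 2) ≤ ((p : ℝ) ^ a) ^ δ := by
    calc 1 + a * (δ * Real.log 2) ≤ Real.exp (a * (δ * Real.log 2)) := by
          linarith [Real.add_one_le_exp (a * (δ * Real.log 2))]
      _ = ((2 : ℝ) ^ a) ^ δ := by
          rw [Real.rpow_def_of_pos (by positivity), Real.log_pow]
          ring_nf
      _ ≤ ((p : ℝ) ^ a) ^ δ := by gcongr
  have h2 : (1 : ℝ) ≤ max 1 (1 / (δ * Real.log 2)) := le_max_left _ _
  have h3 : 1 ≤ max 1 (1 / (δ * Real.log 2)) * (δ * Real.log 2) := by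
    rw [← div_le_iff₀ hl]
    exact le_max_right _ _
  calc (a : ℝ) + 1 ≤ max 1 (1 / (δ * Real.log 2)) * (1 + a * (δ * Real.log 2)) := by
        nlinarith [mul_le_mul_of_nonneg_left h3 (Nat.cast_nonneg (α := ℝ) a)]
    _ ≤ _ := by gcongr

/-- The divisor bound `d(n) = O(n ^ δ)` for every `δ > 0`. -/
theorem exists_card_divisors_le_mul_rpow {δ : ℝ} (hδ : 0 < δ) :
    ∃ C : ℝ, 1 ≤ C ∧ ∀ n : ℕ, n ≠ 0 → (n.divisors.card : ℝ) ≤ C * (n : ℝ) ^ δ := by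
  obtain ⟨C, hC, hbd⟩ := exists_add_one_le_mul_pow_rpow hδ
  obtain ⟨M, hM⟩ := exists_nat_ge ((2 : ℝ) ^ (1 / δ))
  refine ⟨C ^ M, one_le_pow₀ hC, fun n hn => ?_⟩
  have hn_eq : ∏ p ∈ n.primeFactors, (p : ℝ) ^ n.factorization p = n := by
    have h := Nat.prod_factorization_pow_eq_self hn
    rw [Nat.prod_factorization_eq_prod_primeFactors] at h
    exact_mod_cast h
  have hfactor : ∀ p ∈ n.primeFactors, (n.factorization p : ℝ) + 1 ≤
      (if p < M then C else 1) * ((p : ℝ) ^ n.factorization p) ^ δ := by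
    intro p hp
    split_ifs with h
    · exact hbd p _ (Nat.prime_of_mem_primeFactors hp).two_le
    · have hMp : (2 : ℝ) ^ (1 / δ) ≤ p := hM.trans (by exact_mod_cast not_lt.mp h)
      have h2 : (2 : ℝ) ≤ (p : ℝ) ^ δ := by
        calc (2 : ℝ) = ((2 : ℝ) ^ (1 / δ)) ^ δ := by
              rw [← Real.rpow_mul (by norm_num), one_div_mul_cancel hδ.ne', Real.rpow_one]
          _ ≤ _ := by gcongr
      rw [one_mul, ← Real.rpow_natCast, ← Real.rpow_mul (by positivity), mul_comm,
        Real.rpow_mul (by positivity), Real.rpow_natCast]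
      calc (n.factorization p : ℝ) + 1 ≤ (2 : ℝ) ^ n.factorization p := by
            exact_mod_cast Nat.lt_two_pow_self
        _ ≤ _ := by gcongr
  calc (n.divisors.card : ℝ) = ∏ p ∈ n.primeFactors, ((n.factorization p : ℝ) + 1) := by
        rw [Nat.card_divisors hn]
        push_cast
        rfl
    _ ≤ ∏ p ∈ n.primeFactors,
          (if p < M then C else 1) * ((p : ℝ) ^ n.factorization p) ^ δ :=
        Finset.prod_le_prod (fun _ _ => by positivity) hfactor
    _ = (∏ p ∈ n.primeFactors, if p < M then C else 1) * (n : ℝ) ^ δ := by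
        rw [Finset.prod_mul_distrib,
          Real.finsetProd_rpow _ _ (fun _ _ => by positivity), hn_eq]
    _ ≤ C ^ M * (n : ℝ) ^ δ := by
        gcongr
        rw [← Finset.prod_filter, Finset.prod_const]
        refine pow_le_pow_right₀ hC ?_
        calc _ ≤ (Finset.range M).card := Finset.card_le_card fun p hp =>
              Finset.mem_range.mpr (Finset.mem_filter.mp hp).2
          _ = M := Finset.card_range M

theorem one_le_log_log_of_sixteen_le {x : ℝ} (hx : 16 ≤ x) : 1 ≤ Real.log (Real.log x) := by
  have h1 : Real.exp 1 ≤ Real.log x := by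
    have h16 : Real.log 16 = 4 * Real.log 2 := by
      rw [show (16 : ℝ) = 2 ^ 4 by norm_num, Real.log_pow]
      norm_num
    have := Real.log_le_log (by norm_num) hx
    linarith [Real.exp_one_lt_d9, Real.log_two_gt_d9]
  exact (Real.le_log_iff_exp_le ((Real.exp_pos 1).trans_le h1)).mpr h1

/-- The factor `log log p / √(log p)` is absorbed by `p ^ (-m / 2)` when `p ≥ 16` and `m ≥ 1`. -/
theorem pow_rpow_le_rpow_mul_log_log_div_sqrt_log {x : ℝ} (hx : 16 ≤ x) {m : ℕ} (hm : 1 ≤ m)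
    (s : ℝ) :
    (x ^ m) ^ ((s - 1) / 2) ≤
      x ^ (s * m / 2) * Real.log (Real.log x) / Real.sqrt (Real.log x) := by
  have hx0 : 0 < x := by linarith
  have hlog : 0 < Real.log x := Real.log_pos (by linarith)
  have hm' : (1 : ℝ) ≤ m := by exact_mod_cast hm
  have hsqrt : Real.sqrt (Real.log x) ≤ x ^ ((m : ℝ) / 2) := by
    calc Real.sqrt (Real.log x) ≤ Real.sqrt x := Real.sqrt_le_sqrt (Real.log_le_self hx0.le)
      _ = x ^ ((1 : ℝ) / 2) := Real.sqrt_eq_rpow x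
      _ ≤ _ := Real.rpow_le_rpow_of_exponent_le (by linarith) (by linarith)
  rw [le_div_iff₀ (Real.sqrt_pos.mpr hlog), ← Real.rpow_natCast, ← Real.rpow_mul hx0.le]
  calc x ^ (m * ((s - 1) / 2)) * Real.sqrt (Real.log x)
      ≤ x ^ (m * ((s - 1) / 2)) * x ^ ((m : ℝ) / 2) := by gcongr
    _ = x ^ (s * m / 2) := by
        rw [← Real.rpow_add hx0]
        ring_nf
    _ ≤ _ := le_mul_of_one_le_right (by positivity) (one_le_log_log_of_sixteen_le hx)

/-- A lower bound by `n ^ r` at prime powers extends to integers composed of the same primes. -/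
theorem rpow_le_abs_of_rpow_le_abs_prime_pow {f : ℕ → ℝ} (h_one : f 1 = 1)
    (h_mul : ∀ m n : ℕ, Nat.Coprime m n → f (m * n) = f m * f n) {P : Set ℕ} {r : ℝ}
    (h_pow : ∀ p ∈ P, ∀ m : ℕ, 1 ≤ m → ((p : ℝ) ^ m) ^ r ≤ |f (p ^ m)|) (n : ℕ) (hn : n ≠ 0)
    (hP : ∀ q : ℕ, q.Prime → q ∣ n → q ∈ P) : (n : ℝ) ^ r ≤ |f n| := by
  induction n using Nat.recOnPosPrimePosCoprime with
  | zero => exact absurd rfl hn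
  | one => simp [h_one]
  | prime_pow p m hp hm =>
    push_cast
    exact h_pow p (hP p hp (dvd_pow_self p hm.ne')) m hm
  | coprime a b ha hb hab iha ihb =>
    have h1 := iha (by lia) fun q hq hd => hP q hq (hd.mul_right b)
    have h2 := ihb (by lia) fun q hq hd => hP q hq (hd.mul_left a)
    rw [h_mul a b hab, abs_mul, Nat.cast_mul, Real.mul_rpow (by positivity) (by positivity)]
    gcongr

theorem eventually_log_log_log_div_log_log_le {c : ℝ} (hc : 0 < c) :
    ∀ᶠ n : ℕ in Filter.atTop,
      Real.log (Real.log (Real.log n)) / Real.log (Real.log n) ≤ c := by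
  have h : Filter.Tendsto (fun x : ℝ => Real.log x / x) Filter.atTop (nhds 0) :=
    Real.isLittleO_log_id_atTop.tendsto_div_nhds_zero
  exact (h.comp (Real.tendsto_log_atTop.comp (Real.tendsto_log_atTop.comp
    tendsto_natCast_atTop_atTop))).eventually_le_const hc


/-- Atkin–Serre type bounds for almost all integers, for a multiplicative
function satisfying the Gafni–Thorner lower bound on a set of primes `P` and Deligne's
upper bound everywhere. -/
theorem atkin_serre_almost_all
    (k : ℕ) (hk : 4 ≤ k) (lam : ℕ → ℝ)
    (hmul1 : lam 1 = 1)
    (hmul : ∀ m n : ℕ, Nat.Coprime m n → lam (m * n) = lam m * lam n)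
    (P : Set ℕ) (hPprime : ∀ p ∈ P, Nat.Prime p) (hPbig : ∀ p ∈ P, 16 ≤ p)
    (hlow : ∀ p ∈ P, ∀ m : ℕ, 1 ≤ m →
      (p : ℝ) ^ (((k : ℝ) - 1) * (m : ℝ) / 2) * Real.log (Real.log p) / Real.sqrt (Real.log p)
        ≤ |lam (p ^ m)|)
    (hup : ∀ n : ℕ, 1 ≤ n →
      |lam n| ≤ (n.divisors.card : ℝ) * (n : ℝ) ^ (((k : ℝ) - 1) / 2)) :
    ∀ ε : ℝ, 0 < ε → ∃ N : ℕ, ∀ n : ℕ, N ≤ n →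
      (∀ q : ℕ, Nat.Prime q → q ∣ n → q ∈ P) →
      (n : ℝ) ^ (((k : ℝ) - 3) / 2 + Real.log (Real.log (Real.log n)) / Real.log (Real.log n))
          ≤ |lam n| ∧
        |lam n| ≤ (n : ℝ) ^ (((k : ℝ) - 1) / 2 + ε) := by
  intro ε hε
  obtain ⟨C, -, hdiv⟩ := exists_card_divisors_le_mul_rpow (half_pos hε)
  have hC : ∀ᶠ n : ℕ in Filter.atTop, C ≤ (n : ℝ) ^ (ε / 2) :=
    ((tendsto_rpow_atTop (half_pos hε)).comp
      tendsto_natCast_atTop_atTop).eventually_ge_atTop C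
  obtain ⟨N, hN⟩ := Filter.eventually_atTop.mp
    ((eventually_log_log_log_div_log_log_le one_half_pos).and
      (hC.and (Filter.eventually_ge_atTop 1)))
  refine ⟨N, fun n hn hnP => ?_⟩
  obtain ⟨hlogs, hCn, hn1⟩ := hN n hn
  have hn1' : (1 : ℝ) ≤ n := by exact_mod_cast hn1
  have hn0 : (0 : ℝ) < n := by linarith
  constructor
  · calc (n : ℝ) ^ (((k : ℝ) - 3) / 2 + Real.log (Real.log (Real.log n)) / Real.log (Real.log n))
        ≤ (n : ℝ) ^ (((k : ℝ) - 1 - 1) / 2) :=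
          Real.rpow_le_rpow_of_exponent_le hn1' (by linarith)
      _ ≤ |lam n| := by
          refine rpow_le_abs_of_rpow_le_abs_prime_pow hmul1 hmul (P := P) ?_ n (by lia) hnP
          exact fun p hp m hm => (pow_rpow_le_rpow_mul_log_log_div_sqrt_log
            (by exact_mod_cast hPbig p hp) hm _).trans (hlow p hp m hm)
  · calc |lam n| ≤ (n.divisors.card : ℝ) * (n : ℝ) ^ (((k : ℝ) - 1) / 2) := hup n hn1
      _ ≤ (n : ℝ) ^ (ε / 2) * (n : ℝ) ^ (ε / 2) * (n : ℝ) ^ (((k : ℝ) - 1) / 2) := by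
          gcongr
          exact (hdiv n (by lia)).trans (by gcongr)
      _ = (n : ℝ) ^ (((k : ℝ) - 1) / 2 + ε) := by
          rw [← Real.rpow_add hn0, ← Real.rpow_add hn0]
          ring_nf
end

section
/- Let τ ∈ (0, 1] and let P be a set of primes whose counting function satisfies #{p ≤ x : p ∈ P} = τ·x/log x + O(x/(log x)²). Then there exists a constant C_P > 0 such that for all large x, ∏_{p ≤ x, p ∈ P} (1 − 1/p)^(−1) = C_P·(log x)^τ · (1 + O(1/log x)). -/
open scoped Classical

section MertensSubset

open Real Set Filter Topology MeasureTheory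

/-- The function `-1 / log` is an antiderivative of `1 / (t (log t)²)`. -/
lemma hasDerivAt_neg_inv_log {t : ℝ} (ht : 1 < t) :
    HasDerivAt (fun s => -(log s)⁻¹) (1 / (t * log t ^ 2)) t := by
  have hl : log t ≠ 0 := (log_pos ht).ne'
  have ht0 : t ≠ 0 := by positivity
  refine ((hasDerivAt_log ht0).inv hl).neg.congr_deriv ?_
  field_simp

lemma tendsto_neg_inv_log_atTop : Tendsto (fun s => -(log s)⁻¹) atTop (𝓝 0) := by
  simpa using (tendsto_inv_atTop_zero.comp tendsto_log_atTop).neg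

lemma integrableOn_Ioi_one_div_mul_log_sq {a : ℝ} (ha : 1 < a) :
    IntegrableOn (fun t => 1 / (t * log t ^ 2)) (Ioi a) :=
  integrableOn_Ioi_deriv_of_nonneg'
    (fun _ ht => hasDerivAt_neg_inv_log (ha.trans_le ht))
    (fun t ht => by have : 0 < t := by linarith [mem_Ioi.1 ht]
                    positivity)
    tendsto_neg_inv_log_atTop

lemma integral_Ioi_one_div_mul_log_sq {a : ℝ} (ha : 1 < a) :
    ∫ t in Ioi a, 1 / (t * log t ^ 2) = 1 / log a := by
  rw [integral_Ioi_of_hasDerivAt_of_tendsto'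
    (fun t ht => hasDerivAt_neg_inv_log (ha.trans_le ht))
    (integrableOn_Ioi_one_div_mul_log_sq ha) tendsto_neg_inv_log_atTop]
  simp

/-- If `g` is bounded by `K / (t (log t)²)`, then its improper integral converges with tail
`K / log x`. -/
lemma abs_integral_sub_integral_Ioi_le {g : ℝ → ℝ} (hg : Measurable g) {a K : ℝ} (ha : 1 < a)
    (hbound : ∀ t, a ≤ t → |g t| ≤ K * (1 / (t * log t ^ 2))) {x : ℝ} (hx : a ≤ x) :
    |(∫ t in a..x, g t) - ∫ t in Ioi a, g t| ≤ K / log x := by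
  have hint : IntegrableOn g (Ioi a) := by
    refine ((integrableOn_Ioi_one_div_mul_log_sq ha).const_mul K).mono'
      hg.aestronglyMeasurable ?_
    filter_upwards [ae_restrict_mem measurableSet_Ioi] with t ht
    exact hbound t (le_of_lt ht)
  have hsplit := intervalIntegral.integral_interval_add_Ioi hint
    (hint.mono_set (Ioi_subset_Ioi hx))
  rw [← hsplit, sub_add_cancel_left, abs_neg]
  have hx1 := ha.trans_le hx
  calc |∫ t in Ioi x, g t| ≤ ∫ t in Ioi x, K * (1 / (t * log t ^ 2)) := by
        rw [← norm_eq_abs]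
        refine norm_integral_le_of_norm_le
          ((integrableOn_Ioi_one_div_mul_log_sq hx1).const_mul K) ?_
        filter_upwards [ae_restrict_mem measurableSet_Ioi] with t ht
        exact hbound t (hx.trans (le_of_lt ht))
    _ = K / log x := by
        rw [integral_const_mul, integral_Ioi_one_div_mul_log_sq hx1, mul_one_div]

lemma hasDerivAt_neg_log_one_sub_one_div {t : ℝ} (ht : 1 < t) :
    HasDerivAt (fun s => -log (1 - 1 / s)) (-(1 / (t * (t - 1)))) t := by
  have ht0 : t ≠ 0 := by positivity
  have ht1 : t - 1 ≠ 0 := by linarith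
  have h1 : 1 - 1 / t ≠ 0 := by
    rw [one_sub_div ht0]; exact div_ne_zero ht1 ht0
  have h := (((hasDerivAt_inv ht0).const_sub 1).log (by simpa using h1)).neg
  simp only [← one_div] at h
  refine h.congr_deriv ?_
  field_simp

/-- Abel summation for the logarithm of a partial Euler product. -/
lemma sum_neg_log_one_sub_one_div_eq (c : ℕ → ℝ) (h0 : c 0 = 0) (h1 : c 1 = 0) {x : ℝ}
    (hx : 2 ≤ x) :
    ∑ n ∈ Finset.Icc 0 ⌊x⌋₊, -log (1 - 1 / (n : ℝ)) * c n =
      -log (1 - 1 / x) * (∑ n ∈ Finset.Icc 0 ⌊x⌋₊, c n) +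
        ∫ t in (2 : ℝ)..x, 1 / (t * (t - 1)) * ∑ n ∈ Finset.Icc 0 ⌊t⌋₊, c n := by
  have hd : ∀ t ∈ Icc 2 x,
      HasDerivAt (fun s : ℝ => -log (1 - 1 / s)) (-(1 / (t * (t - 1)))) t :=
    fun t ht => hasDerivAt_neg_log_one_sub_one_div (by linarith [ht.1])
  have hint : IntegrableOn (deriv fun s : ℝ => -log (1 - 1 / s)) (Icc 2 x) := by
    rw [integrableOn_congr_fun (fun t ht => (hd t ht).deriv) measurableSet_Icc]
    refine ContinuousOn.integrableOn_Icc (ContinuousOn.neg (ContinuousOn.div (by fun_prop)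
      (by fun_prop) fun t ht => ?_))
    exact mul_ne_zero (by linarith [ht.1]) (by linarith [ht.1])
  rw [sum_mul_eq_sub_integral_mul₁ c h0 h1 x (fun t ht => (hd t ht).differentiableAt) hint,
    sub_eq_add_neg, ← integral_neg, intervalIntegral.integral_of_le hx]
  congr 1
  refine setIntegral_congr_fun measurableSet_Ioc fun t ht => ?_
  simp only [(hd t ⟨ht.1.le, ht.2⟩).deriv]
  ring

lemma integral_one_div_mul_log {x : ℝ} (hx : 2 ≤ x) :
    ∫ t in (2 : ℝ)..x, 1 / (t * log t) = log (log x) - log (log 2) := by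
  have hpos : ∀ t ∈ uIcc 2 x, 1 < t := fun t ht => by
    rw [uIcc_of_le hx] at ht; linarith [ht.1]
  refine intervalIntegral.integral_eq_sub_of_hasDerivAt (f := fun t => log (log t))
    (fun t ht => ?_) ?_
  · have := hpos t ht
    refine ((hasDerivAt_log (by positivity : t ≠ 0)).log (log_pos this).ne').congr_deriv ?_
    field_simp
  · refine ContinuousOn.intervalIntegrable (ContinuousOn.div (by fun_prop)
      (continuousOn_id.mul (continuousOn_log.mono fun t ht => ?_)) fun t ht => ?_)
    · have := hpos t ht
      exact (by positivity : t ≠ 0)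
    · have := hpos t ht
      exact mul_ne_zero (by positivity) (log_pos this).ne'

lemma neg_log_one_sub_one_div_nonneg {x : ℝ} (hx : 2 ≤ x) : 0 ≤ -log (1 - 1 / x) := by
  have h : 1 / x ≤ 1 := by rw [div_le_one (by linarith)]; linarith
  have h' : 0 ≤ 1 / x := by positivity
  exact neg_nonneg.2 (log_nonpos (by linarith) (by linarith))

lemma neg_log_one_sub_one_div_le {x : ℝ} (hx : 2 ≤ x) : -log (1 - 1 / x) ≤ 2 / x := by
  have hx1 : 0 < x - 1 := by linarith
  have hx0 : 0 < x := by linarith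
  rw [one_sub_div hx0.ne', ← log_inv, inv_div]
  refine (log_le_sub_one_of_pos (by positivity)).trans ?_
  rw [div_sub_one hx1.ne', div_le_div_iff₀ hx1 hx0]
  linarith

/-- The difference of the two integrands in Abel summation is `O(1 / (t (log t)²))`. -/
lemma abs_div_sub_div_mul_log_le {τ C t A : ℝ} (hτ : 0 ≤ τ) (ht : 2 ≤ t)
    (hA : |A - τ * t / log t| ≤ C * t / log t ^ 2) :
    |1 / (t * (t - 1)) * A - τ * (1 / (t * log t))| ≤
      (2 * C + 2 * τ) * (1 / (t * log t ^ 2)) := by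
  have hl : 0 < log t := log_pos (by linarith)
  have ht1 : 0 < t - 1 := by linarith
  have ht0 : 0 < t := by linarith
  have hC : 0 ≤ C * t / log t ^ 2 := (abs_nonneg _).trans hA
  have hinv : 1 / (t * (t - 1)) ≤ 2 / t ^ 2 := by
    rw [div_le_div_iff₀ (by positivity) (by positivity)]
    nlinarith
  have hlt : log t ≤ t := (log_le_sub_one_of_pos ht0).trans (by linarith)
  have hsplit : 1 / (t * (t - 1)) * A - τ * (1 / (t * log t)) =
      1 / (t * (t - 1)) * (A - τ * t / log t) + 1 / (t * (t - 1)) * (τ / log t) := by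
    field_simp
    ring
  calc _ ≤ 1 / (t * (t - 1)) * |A - τ * t / log t| + 1 / (t * (t - 1)) * (τ / log t) := by
        rw [hsplit]
        refine (abs_add_le _ _).trans (le_of_eq ?_)
        rw [abs_mul, abs_of_pos (by positivity : 0 < 1 / (t * (t - 1))),
          abs_of_nonneg (by positivity : 0 ≤ 1 / (t * (t - 1)) * (τ / log t))]
    _ ≤ 2 / t ^ 2 * (C * t / log t ^ 2) + 2 / t ^ 2 * (τ * t / log t ^ 2) := by
        have h : τ / log t ≤ τ * t / log t ^ 2 := by
          rw [div_le_div_iff₀ hl (by positivity)]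
          have := mul_le_mul_of_nonneg_left hlt (by positivity : 0 ≤ τ * log t)
          nlinarith
        gcongr
    _ = _ := by field_simp

/-- If the summatory function of `c` is `τ x / log x + O(x / (log x)²)`, then
`∑ n ≤ x, -log (1 - 1/n) * c n = τ log log x + B + O(1 / log x)`. -/
theorem exists_abs_sum_neg_log_one_sub_one_div_le {τ C : ℝ} (hτ : 0 ≤ τ) (c : ℕ → ℝ)
    (h0 : c 0 = 0) (h1 : c 1 = 0)
    (hcount : ∀ x : ℝ, 2 ≤ x →
      |(∑ n ∈ Finset.Icc 0 ⌊x⌋₊, c n) - τ * x / log x| ≤ C * x / log x ^ 2) :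
    ∃ B K : ℝ, 0 ≤ K ∧ ∀ x : ℝ, 3 ≤ x →
      |(∑ n ∈ Finset.Icc 0 ⌊x⌋₊, -log (1 - 1 / (n : ℝ)) * c n) - (τ * log (log x) + B)| ≤
        K / log x := by
  set A : ℝ → ℝ := fun x => ∑ n ∈ Finset.Icc 0 ⌊x⌋₊, c n with hAdef
  have hC : 0 ≤ C := by
    have h := (abs_nonneg _).trans (hcount 2 le_rfl)
    have hl : 0 < log 2 := log_pos one_lt_two
    rw [le_div_iff₀ (by positivity)] at h
    linarith
  set g : ℝ → ℝ := fun t => 1 / (t * (t - 1)) * A t - τ * (1 / (t * log t)) with hg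
  have hAm : Measurable A :=
    (measurable_from_top (f := fun m : ℕ => ∑ n ∈ Finset.Icc 0 m, c n)).comp Nat.measurable_floor
  have hgm : Measurable g := by fun_prop
  refine ⟨(∫ t in Ioi 2, g t) - τ * log (log 2), 2 * (τ + C) + (2 * C + 2 * τ), by positivity,
    fun x hx => ?_⟩
  have hx2 : (2 : ℝ) ≤ x := by linarith
  have hlx : 1 ≤ log x := by
    rw [le_log_iff_exp_le (by linarith)]
    linarith [exp_one_lt_d9]
  have htail := abs_integral_sub_integral_Ioi_le hgm one_lt_two
    (fun t ht => abs_div_sub_div_mul_log_le hτ ht (hcount t ht)) hx2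
  have hA : |A x| ≤ (τ + C) * x / log x := by
    have h := abs_add_le (A x - τ * x / log x) (τ * x / log x)
    rw [sub_add_cancel, abs_of_nonneg (by positivity : 0 ≤ τ * x / log x)] at h
    have h2 : C * x / log x ^ 2 ≤ C * x / log x := by
      gcongr
      nlinarith
    calc |A x| ≤ C * x / log x + τ * x / log x := by linarith [hcount x hx2]
      _ = _ := by ring
  have hmain : |-log (1 - 1 / x) * A x| ≤ 2 * (τ + C) / log x := by
    rw [abs_mul, abs_of_nonneg (neg_log_one_sub_one_div_nonneg hx2)]
    calc _ ≤ 2 / x * ((τ + C) * x / log x) := by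
          gcongr
          exact neg_log_one_sub_one_div_le hx2
      _ = _ := by field_simp
  have hint₁ : IntervalIntegrable (fun t => 1 / (t * (t - 1)) * A t) volume 2 x := by
    rw [intervalIntegrable_iff_integrableOn_Icc_of_le hx2]
    refine integrableOn_mul_sum_Icc c zero_le_two (ContinuousOn.integrableOn_Icc
      (ContinuousOn.div (by fun_prop) (by fun_prop) fun t ht => ?_))
    exact mul_ne_zero (by linarith [ht.1]) (by linarith [ht.1])
  have hint₂ : IntervalIntegrable (fun t => τ * (1 / (t * log t))) volume 2 x := by
    refine (ContinuousOn.intervalIntegrable (ContinuousOn.div (by fun_prop)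
      (continuousOn_id.mul (continuousOn_log.mono fun t ht => ?_)) fun t ht => ?_)).const_mul τ
    all_goals rw [uIcc_of_le hx2] at ht
    · exact (by linarith [ht.1] : t ≠ 0)
    · exact mul_ne_zero (by simp only [id]; linarith [ht.1]) (log_pos (by linarith [ht.1])).ne'
  have hgint : ∫ t in (2 : ℝ)..x, g t = (∫ t in (2 : ℝ)..x, 1 / (t * (t - 1)) * A t) -
      τ * (log (log x) - log (log 2)) := by
    rw [hg, intervalIntegral.integral_sub hint₁ hint₂, intervalIntegral.integral_const_mul,
      integral_one_div_mul_log hx2]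
  rw [sum_neg_log_one_sub_one_div_eq c h0 h1 hx2]
  calc _ = |-log (1 - 1 / x) * A x + ((∫ t in (2 : ℝ)..x, g t) - ∫ t in Ioi 2, g t)| := by
        rw [hgint]
        congr 1
        simp only [hAdef]
        ring
    _ ≤ _ := abs_add_le _ _
    _ ≤ _ := add_le_add hmain htail
    _ = _ := by ring

end MertensSubset

/-- Mertens-type theorem for the Euler product over a set of primes of
density `τ`: the product `∏_{p ≤ x, p ∈ P} (1 − 1/p)⁻¹` equals
`C_P (log x)^τ (1 + O(1/log x))`. -/
theorem mertens_product_over_prime_subset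
    (τ : ℝ) (hτ0 : 0 < τ) (hτ1 : τ ≤ 1)
    (P : Set ℕ) (hP : ∀ p ∈ P, Nat.Prime p) (C : ℝ)
    (hcount : ∀ x : ℝ, 2 ≤ x →
      |(((Finset.range (⌊x⌋₊ + 1)).filter (fun p => p ∈ P)).card : ℝ)
          - τ * x / Real.log x|
        ≤ C * x / (Real.log x) ^ 2) :
    ∃ CP : ℝ, 0 < CP ∧ ∃ K : ℝ, ∃ x₀ : ℝ, ∀ x : ℝ, x₀ ≤ x →
      |(∏ q ∈ (Finset.range (⌊x⌋₊ + 1)).filter (fun p => p ∈ P),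
            (1 - 1 / (q : ℝ))⁻¹)
          - CP * Real.log x ^ τ|
        ≤ K * Real.log x ^ τ / Real.log x := by
  set c : ℕ → ℝ := fun n => if n ∈ P then 1 else 0 with hc
  have h0 : c 0 = 0 := if_neg fun h => Nat.not_prime_zero (hP 0 h)
  have h1 : c 1 = 0 := if_neg fun h => Nat.not_prime_one (hP 1 h)
  obtain ⟨B, K, hK, hsum⟩ := exists_abs_sum_neg_log_one_sub_one_div_le (C := C) hτ0.le c h0 h1
    (fun x hx => by
      have := hcount x hx
      rwa [Nat.range_succ_eq_Icc_zero, Finset.card_filter, Nat.cast_sum,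
        Finset.sum_congr rfl fun n _ => Nat.cast_ite (n ∈ P) 1 0, Nat.cast_one,
        Nat.cast_zero] at this)
  refine ⟨Real.exp B, Real.exp_pos B, Real.exp B * (2 * K), max 3 (Real.exp K), fun x hx => ?_⟩
  have hx3 : 3 ≤ x := (le_max_left _ _).trans hx
  have hl : 0 < Real.log x := Real.log_pos (by linarith)
  have hKl : K / Real.log x ≤ 1 := by
    rw [div_le_one hl, Real.le_log_iff_exp_le (by linarith)]
    exact (le_max_right _ _).trans hx
  have hE := hsum x hx3
  set S := ∑ n ∈ Finset.Icc 0 ⌊x⌋₊, -Real.log (1 - 1 / (n : ℝ)) * c n with hS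
  set E := S - (τ * Real.log (Real.log x) + B) with hEdef
  have hprod : ∏ q ∈ (Finset.range (⌊x⌋₊ + 1)).filter (fun p => p ∈ P), (1 - 1 / (q : ℝ))⁻¹ =
      Real.exp B * Real.log x ^ τ * Real.exp E := by
    rw [Real.rpow_def_of_pos hl, ← Real.exp_add, ← Real.exp_add,
      show B + Real.log (Real.log x) * τ + E = S by rw [hEdef]; ring, hS,
      ← Nat.range_succ_eq_Icc_zero]
    simp only [hc, mul_ite, mul_one, mul_zero]
    rw [← Finset.sum_filter, Real.exp_sum]
    refine Finset.prod_congr rfl fun q hq => ?_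
    have hq1 : (1 : ℝ) < q := by exact_mod_cast (hP q (Finset.mem_filter.1 hq).2).one_lt
    rw [Real.exp_neg, Real.exp_log]
    rw [sub_pos, div_lt_one (by linarith)]
    exact hq1
  have hexp : |Real.exp E - 1| ≤ 2 * (K / Real.log x) :=
    (Real.abs_exp_sub_one_le (hE.trans hKl)).trans (by linarith)
  have hpos : 0 ≤ Real.exp B * Real.log x ^ τ := by positivity
  rw [hprod, ← mul_sub_one, abs_mul, abs_of_nonneg hpos]
  calc _ ≤ Real.exp B * Real.log x ^ τ * (2 * (K / Real.log x)) :=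
        mul_le_mul_of_nonneg_left hexp hpos
    _ = _ := by ring
end
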